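/- Let Ω ⊆ ℂⁿ be a bounded domain and let u ≥ 0 be a plurisubharmonic function on Ω belonging to ℳ. If u is tame, then the functions u_n = u − S_n u (n = 1, 2, …) form an increasing sequence of plurisubharmonic functions on Ω, each bounded above (indeed u_n ≤ n), which converges to u at every point of Ω outside a pluripolar set. In particular, a tame plurisubharmonic u ∈ ℳ is the limit of an increasing sequence of upper bounded plurisubharmonic functions outside a pluripolar set. -/

import Mathlib

open Complex Polynomial Filter Set Topology

noncomputable section

/-- `u` is plurisubharmonic on `Ω ⊆ ℂⁿ`: it is upper semicontinuous on `Ω`, takes values in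
`[-∞, ∞)`, is not identically `-∞`, and on every closed disc of every complex line contained
in `Ω` it satisfies the maximum principle against real parts of complex polynomials
(an equivalent formulation of subharmonicity of the restriction to every complex line). -/
def IsPSH {n : ℕ} (Ω : Set (Fin n → ℂ)) (u : (Fin n → ℂ) → EReal) : Prop :=
  UpperSemicontinuousOn u Ω ∧
  (∀ z ∈ Ω, u z ≠ ⊤) ∧
  (∃ z ∈ Ω, u z ≠ ⊥) ∧
  ∀ z ∈ Ω, ∀ w : Fin n → ℂ, ∀ r : ℝ, 0 < r →
    (∀ ζ : ℂ, ‖ζ‖ ≤ r → z + ζ • w ∈ Ω) →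
    ∀ p : Polynomial ℂ,
      (∀ ζ : ℂ, ‖ζ‖ = r → u (z + ζ • w) ≤ (((p.eval ζ).re : ℝ) : EReal)) →
      ∀ ζ : ℂ, ‖ζ‖ ≤ r → u (z + ζ • w) ≤ (((p.eval ζ).re : ℝ) : EReal)

/-- `v` is plurisuperharmonic on `Ω` iff `-v` is plurisubharmonic on `Ω`. -/
def IsPSupH {n : ℕ} (Ω : Set (Fin n → ℂ)) (v : (Fin n → ℂ) → EReal) : Prop :=
  IsPSH Ω (fun z => -(v z))

/-- `f` belongs to the class `ℳ`: `f : Ω → [0, +∞]` admits a plurisuperharmonic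
majorant on `Ω`. -/
def MemM {n : ℕ} (Ω : Set (Fin n → ℂ)) (f : (Fin n → ℂ) → EReal) : Prop :=
  (∀ z ∈ Ω, 0 ≤ f z) ∧ ∃ v, IsPSupH Ω v ∧ ∀ z ∈ Ω, f z ≤ v z

/-- The reduced function `R_λ f`: the pointwise infimum of all plurisuperharmonic
majorants of `(f - λ)⁺ = max {f - λ, 0}` on `Ω`. -/
def Rop {n : ℕ} (Ω : Set (Fin n → ℂ)) (f : (Fin n → ℂ) → EReal) (lam : ℝ)
    (z : Fin n → ℂ) : EReal :=
  sInf { y | ∃ v, IsPSupH Ω v ∧ (∀ ζ ∈ Ω, max (f ζ - (lam : EReal)) 0 ≤ v ζ) ∧ y = v z }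

/-- Lower semicontinuous regularization of `g` relative to the set `A`:
`g_*(z) = liminf_{A ∋ ζ → z} g(ζ)`. -/
def lscReg {n : ℕ} (A : Set (Fin n → ℂ)) (g : (Fin n → ℂ) → EReal)
    (z : Fin n → ℂ) : EReal :=
  liminf g (nhdsWithin z A)

/-- Upper semicontinuous regularization of `g` relative to the set `A`:
`g*(z) = limsup_{A ∋ ζ → z} g(ζ)`. -/
def uscReg {n : ℕ} (A : Set (Fin n → ℂ)) (g : (Fin n → ℂ) → EReal)
    (z : Fin n → ℂ) : EReal :=
  limsup g (nhdsWithin z A)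

/-- `S_λ f`: the lower semicontinuous regularization of `R_λ f` on `Ω`. -/
def Slam {n : ℕ} (Ω : Set (Fin n → ℂ)) (f : (Fin n → ℂ) → EReal) (lam : ℝ) :
    (Fin n → ℂ) → EReal :=
  lscReg Ω (Rop Ω f lam)

/-- The operator `S`: the lower semicontinuous regularization of
`lim_{λ → ∞} S_λ f`; since `λ ↦ S_λ f` is decreasing on `λ ≥ 0`, this limit is the
infimum over `λ ≥ 0`. -/
def Sop {n : ℕ} (Ω : Set (Fin n → ℂ)) (f : (Fin n → ℂ) → EReal) :
    (Fin n → ℂ) → EReal :=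
  lscReg Ω (fun z => ⨅ (lam : ℝ) (_ : 0 ≤ lam), Slam Ω f lam z)

/-- `f` is tame on `Ω` if `S f ≡ 0`. -/
def Tame {n : ℕ} (Ω : Set (Fin n → ℂ)) (f : (Fin n → ℂ) → EReal) : Prop :=
  ∀ z ∈ Ω, Sop Ω f z = 0

/-- `E` is a pluripolar subset of `Ω`: `E ⊆ {w = -∞}` for some plurisubharmonic `w` on `Ω`. -/
def Pluripolar {n : ℕ} (Ω : Set (Fin n → ℂ)) (E : Set (Fin n → ℂ)) : Prop :=
  E ⊆ Ω ∧ ∃ w, IsPSH Ω w ∧ ∀ z ∈ E, w z = ⊥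


theorem exists_continuous_between {X : Type*} [MetricSpace X] {K : Set X} (hK : IsClosed K)
    {a b : X → EReal} (ha : UpperSemicontinuousOn a K) (hb : LowerSemicontinuousOn b K)
    (hab : ∀ x ∈ K, a x < b x) :
    ∃ h : C(X, ℝ), ∀ x ∈ K, a x < (h x : EReal) ∧ (h x : EReal) < b x := by
  refine exists_continuous_forall_mem_convex_of_local_const
    (t := fun x => {c : ℝ | x ∈ K → a x < (c : EReal) ∧ (c : EReal) < b x}) ?_ ?_
  · intro x
    by_cases hx : x ∈ K
    · simp only [hx, forall_true_left]
      refine Set.OrdConnected.convex ⟨?_⟩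
      rintro c ⟨hc, -⟩ d ⟨-, hd⟩ e ⟨hce, hed⟩
      exact ⟨hc.trans_le (by exact_mod_cast hce), lt_of_le_of_lt (by exact_mod_cast hed) hd⟩
    · simpa [hx] using convex_univ
  · intro x
    by_cases hx : x ∈ K
    · obtain ⟨c, hac, hcb⟩ := EReal.lt_iff_exists_real_btwn.1 (hab x hx)
      refine ⟨c, ?_⟩
      have h1 := eventually_nhdsWithin_iff.1 (ha x hx _ hac)
      have h2 := eventually_nhdsWithin_iff.1 (hb x hx _ hcb)
      filter_upwards [h1, h2] with y hy1 hy2 hy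
      exact ⟨hy1 hy, hy2 hy⟩
    · refine ⟨0, ?_⟩
      filter_upwards [hK.isOpen_compl.mem_nhds hx] with y hy hy'
      exact absurd hy' hy

theorem exists_polynomial_of_mem_span_fourier [Fact (0 < 2 * Real.pi)] {r : ℝ} (hr : 0 < r)
    (f : C(AddCircle (2 * Real.pi), ℂ))
    (hf : f ∈ Submodule.span ℂ (Set.range (@fourier (2 * Real.pi)))) :
    ∃ p q : Polynomial ℂ, ∀ x : AddCircle (2 * Real.pi),
      f x = p.eval (r * (AddCircle.toCircle x : ℂ)) +
        (starRingEnd ℂ) (q.eval (r * (AddCircle.toCircle x : ℂ))) := by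
  have hr' : (r : ℂ) ≠ 0 := by exact_mod_cast hr.ne'
  have hnat : ∀ (k : ℕ) (x : AddCircle (2 * Real.pi)), fourier (k : ℤ) x =
      (Polynomial.C (((r : ℂ) ^ k)⁻¹) * Polynomial.X ^ k).eval
        (r * (AddCircle.toCircle x : ℂ)) := by
    intro k x
    simp only [Polynomial.eval_mul, Polynomial.eval_C, Polynomial.eval_pow, Polynomial.eval_X,
      mul_pow, fourier_apply, AddCircle.toCircle_zsmul, zpow_natCast, Circle.coe_pow]
    field_simp
  induction hf using Submodule.span_induction with
  | mem f hf =>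
    obtain ⟨k, rfl⟩ := hf
    obtain ⟨k, rfl | rfl⟩ := k.eq_nat_or_neg
    · exact ⟨Polynomial.C (((r : ℂ) ^ k)⁻¹) * Polynomial.X ^ k, 0, fun x => by rw [hnat]; simp⟩
    · exact ⟨0, Polynomial.C (((r : ℂ) ^ k)⁻¹) * Polynomial.X ^ k,
        fun x => by rw [fourier_neg, hnat]; simp⟩
  | zero => exact ⟨0, 0, by simp⟩
  | add f g _ _ hf hg =>
    obtain ⟨p, q, h⟩ := hf
    obtain ⟨p', q', h'⟩ := hg
    exact ⟨p + p', q + q', fun x => by simp [h, h']; ring⟩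
  | smul c f _ hf =>
    obtain ⟨p, q, h⟩ := hf
    exact ⟨Polynomial.C c * p, Polynomial.C ((starRingEnd ℂ) c) * q,
      fun x => by simp [h]; ring⟩

/-- Real parts of polynomials are uniformly dense in the continuous functions on a circle. -/
theorem exists_polynomial_re_near (h : ℂ → ℝ) (hh : Continuous h) {r : ℝ} (hr : 0 < r)
    {ε : ℝ} (hε : 0 < ε) :
    ∃ p : Polynomial ℂ, ∀ ζ : ℂ, ‖ζ‖ = r → |(p.eval ζ).re - h ζ| < ε := by
  have : Fact (0 < 2 * Real.pi) := ⟨Real.two_pi_pos⟩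
  let f : C(AddCircle (2 * Real.pi), ℂ) :=
    ⟨fun x => ((h (r * (AddCircle.toCircle x : ℂ)) : ℝ) : ℂ), by
      have : Continuous (fun x : AddCircle (2 * Real.pi) => (AddCircle.toCircle x : ℂ)) :=
        continuous_subtype_val.comp AddCircle.continuous_toCircle
      fun_prop⟩
  have hf : f ∈ closure (Submodule.span ℂ (Set.range (@fourier (2 * Real.pi))) :
      Set C(AddCircle (2 * Real.pi), ℂ)) := by
    rw [← Submodule.topologicalClosure_coe, span_fourier_closure_eq_top]
    trivial
  obtain ⟨g, hg, hfg⟩ := Metric.mem_closure_iff.1 hf ε hε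
  obtain ⟨p, q, hpq⟩ := exists_polynomial_of_mem_span_fourier hr g hg
  refine ⟨p + q, fun ζ hζ => ?_⟩
  obtain ⟨x, hx⟩ : ∃ x : AddCircle (2 * Real.pi), r * (AddCircle.toCircle x : ℂ) = ζ := by
    refine ⟨(Complex.arg ζ : ℝ), ?_⟩
    rw [AddCircle.toCircle_apply_mk, Circle.coe_exp, ← hζ]
    simp
  have h1 := (ContinuousMap.dist_lt_iff hε).1 hfg x
  have h2 := hpq x
  rw [hx] at h2
  have h3 : f x = ((h ζ : ℝ) : ℂ) := by rw [← hx]; rfl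
  rw [h3, h2, dist_comm, dist_eq_norm] at h1
  refine lt_of_le_of_lt (le_of_eq_of_le ?_ (Complex.abs_re_le_norm _)) h1
  simp

theorem continuous_complexLine {n : ℕ} (z w : Fin n → ℂ) :
    Continuous fun ζ : ℂ => z + ζ • w := by fun_prop

theorem EReal.le_of_forall_pos_le_add_coe {a : EReal} {c : ℝ}
    (h : ∀ ε : ℝ, 0 < ε → a ≤ ((c + ε : ℝ) : EReal)) : a ≤ (c : EReal) := by
  refine EReal.le_of_forall_lt_iff_le.1 fun x hx => ?_
  have hx' : c < x := by exact_mod_cast hx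
  simpa using h (x - c) (by linarith)

theorem EReal.coe_le_of_forall_pos_sub_le {a : EReal} {c : ℝ}
    (h : ∀ ε : ℝ, 0 < ε → ((c - ε : ℝ) : EReal) ≤ a) : (c : EReal) ≤ a := by
  refine EReal.ge_of_forall_gt_iff_ge.1 fun x hx => ?_
  have hx' : x < c := by exact_mod_cast hx
  simpa using h (c - x) (by linarith)

theorem IsPSH.add {n : ℕ} {Ω : Set (Fin n → ℂ)} {u v : (Fin n → ℂ) → EReal}
    (hu : IsPSH Ω u) (hv : IsPSH Ω v) (hne : ∃ z ∈ Ω, u z ≠ ⊥ ∧ v z ≠ ⊥) :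
    IsPSH Ω (fun z => u z + v z) := by
  obtain ⟨hu1, hu2, -, hu4⟩ := hu
  obtain ⟨hv1, hv2, -, hv4⟩ := hv
  refine ⟨?_, ?_, ?_, ?_⟩
  · exact hu1.add' hv1 fun x hx => EReal.continuousAt_add (Or.inl (hu2 x hx)) (Or.inr (hv2 x hx))
  · exact fun z hz => EReal.add_ne_top (hu2 z hz) (hv2 z hz)
  · obtain ⟨z, hz, h1, h2⟩ := hne
    exact ⟨z, hz, EReal.add_ne_bot_iff.2 ⟨h1, h2⟩⟩
  · intro z hz w r hr hdisc p hp ζ hζ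
    have hmaps : MapsTo (fun ζ : ℂ => z + ζ • w) (Metric.sphere 0 r) Ω := fun ζ hζ =>
      hdisc ζ (by simpa using (mem_sphere_zero_iff_norm.1 hζ).le)
    have hcont := (continuous_complexLine z w).continuousOn (s := Metric.sphere 0 r)
    refine EReal.le_of_forall_pos_le_add_coe fun ε hε => ?_
    have hlsc : LowerSemicontinuousOn
        (fun ζ : ℂ => (((p.eval ζ).re + ε / 3 : ℝ) : EReal) + -(v (z + ζ • w)))
        (Metric.sphere 0 r) := by
      refine LowerSemicontinuousOn.add' ?_ ?_ ?_
      · exact (continuous_coe_real_ereal.comp ((Complex.continuous_re.comp p.continuous).add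
          continuous_const)).lowerSemicontinuous.lowerSemicontinuousOn _
      · exact continuous_neg.comp_upperSemicontinuousOn_antitone
          (hv1.comp hcont hmaps) (fun a b h => EReal.neg_le_neg_iff.2 h)
      · intro x hx
        exact EReal.continuousAt_add (Or.inl (EReal.coe_ne_top _)) (Or.inl (EReal.coe_ne_bot _))
    obtain ⟨h, hh⟩ := exists_continuous_between Metric.isClosed_sphere
      (hu1.comp hcont hmaps) hlsc (by
        intro x hx
        have h1 := hp x (mem_sphere_zero_iff_norm.1 hx)
        have h2 := hu2 _ (hmaps hx)
        have h3 := hv2 _ (hmaps hx)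
        simp only [Function.comp_apply] at *
        generalize u (z + x • w) = a at *
        generalize v (z + x • w) = b at *
        induction a with
        | bot =>
          induction b with
          | bot => simp
          | coe b => simp only [← EReal.coe_neg, ← EReal.coe_add]; exact EReal.bot_lt_coe _
          | top => simp at h3
        | coe a =>
          induction b with
          | bot => simp only [EReal.neg_bot, EReal.coe_add_top]; exact EReal.coe_lt_top _
          | coe b =>
            norm_cast at *
            linarith
          | top => simp at h3
        | top => simp at h2)
    obtain ⟨q, hq⟩ := exists_polynomial_re_near h h.continuous hr (ε := ε / 3) (by positivity)
    have key1 := hu4 z hz w r hr hdisc (q + Polynomial.C ((ε / 3 : ℝ) : ℂ)) (by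
      intro ξ hξ
      refine (hh ξ (by simpa using hξ)).1.le.trans ?_
      have := abs_lt.1 (hq ξ hξ)
      simp only [Polynomial.eval_add, Polynomial.eval_C, Complex.add_re, Complex.ofReal_re]
      exact_mod_cast (by linarith)) ζ hζ
    have key2 := hv4 z hz w r hr hdisc (p - q + Polynomial.C ((2 * ε / 3 : ℝ) : ℂ)) (by
      intro ξ hξ
      have h1 := (hh ξ (by simpa using hξ)).2
      have h2 := abs_lt.1 (hq ξ hξ)
      have h3 := hv2 _ (hdisc ξ hξ.le)
      simp only [Polynomial.eval_add, Polynomial.eval_sub, Polynomial.eval_C, Complex.add_re,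
        Complex.sub_re, Complex.ofReal_re]
      generalize v (z + ξ • w) = b at *
      induction b with
      | bot => simp
      | coe b => norm_cast at *; linarith
      | top => simp at h3) ζ hζ
    refine (add_le_add key1 key2).trans ?_
    simp only [Polynomial.eval_add, Polynomial.eval_sub, Polynomial.eval_C, Complex.add_re,
        Complex.sub_re, Complex.ofReal_re]
    norm_cast
    linarith

/-- The infimum of a decreasing sequence of psh functions is psh unless it is identically `-∞`. -/
theorem IsPSH.iInf_of_antitone {n : ℕ} {Ω : Set (Fin n → ℂ)} {φ : ℕ → (Fin n → ℂ) → EReal}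
    (hφ : ∀ k, IsPSH Ω (φ k)) (hanti : ∀ z ∈ Ω, Antitone fun k => φ k z)
    (hne : ∃ z ∈ Ω, (⨅ k, φ k z) ≠ ⊥) : IsPSH Ω (fun z => ⨅ k, φ k z) := by
  refine ⟨?_, ?_, hne, ?_⟩
  · exact upperSemicontinuousOn_iInf fun k => (hφ k).1
  · intro z hz h
    exact (hφ 0).2.1 z hz (top_le_iff.1 (h.symm.le.trans (iInf_le _ 0)))
  · intro z hz w r hr hdisc p hp ζ hζ
    refine EReal.le_of_forall_pos_le_add_coe fun ε hε => ?_
    have hmaps : MapsTo (fun ζ : ℂ => z + ζ • w) (Metric.sphere 0 r) Ω := fun ζ hζ =>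
      hdisc ζ (by simpa using (mem_sphere_zero_iff_norm.1 hζ).le)
    have hcont := (continuous_complexLine z w).continuousOn (s := Metric.sphere 0 r)
    have hloc : ∀ ξ ∈ Metric.sphere (0 : ℂ) r, ∃ t ∈ 𝓝[Metric.sphere (0 : ℂ) r] ξ,
        ∃ k, ∀ ξ' ∈ t, ξ' ∈ Metric.sphere (0 : ℂ) r →
          φ k (z + ξ' • w) ≤ (((p.eval ξ').re + ε : ℝ) : EReal) := by
      intro ξ hξ
      have h1 : (⨅ k, φ k (z + ξ • w)) < (((p.eval ξ).re + ε / 2 : ℝ) : EReal) :=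
        (hp ξ (by simpa using hξ)).trans_lt (by norm_cast; linarith)
      obtain ⟨k, hk⟩ := iInf_lt_iff.1 h1
      have h2 := ((hφ k).1.comp hcont hmaps) ξ hξ _ hk
      have h3 : ∀ᶠ ξ' in 𝓝[Metric.sphere (0 : ℂ) r] ξ, (p.eval ξ).re - ε / 2 < (p.eval ξ').re :=
        ((Complex.continuous_re.comp p.continuous).continuousWithinAt).eventually_const_lt
          (by simp only [Function.comp_apply]; linarith)
      refine ⟨_, h2.and h3, k, fun ξ' hξ' _ => hξ'.1.le.trans ?_⟩
      have := hξ'.2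
      norm_cast
      linarith
    obtain ⟨k, hk⟩ : ∃ k, ∀ ξ ∈ Metric.sphere (0 : ℂ) r,
        φ k (z + ξ • w) ≤ (((p.eval ξ).re + ε : ℝ) : EReal) := by
      refine (isCompact_sphere (0 : ℂ) r).induction_on
        (p := fun s => ∃ k, ∀ ξ ∈ s, ξ ∈ Metric.sphere (0 : ℂ) r →
          φ k (z + ξ • w) ≤ (((p.eval ξ).re + ε : ℝ) : EReal)) ?_ ?_ ?_ hloc |>.imp
          fun k hk ξ hξ => hk ξ hξ hξ
      · exact ⟨0, by simp⟩
      · exact fun s t hst ⟨k, hk⟩ => ⟨k, fun ξ hξ => hk ξ (hst hξ)⟩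
      · rintro s t ⟨k, hk⟩ ⟨l, hl⟩
        refine ⟨max k l, ?_⟩
        rintro ξ (hξ | hξ) hξr
        · exact (hanti _ (hmaps hξr) (le_max_left k l)).trans (hk ξ hξ hξr)
        · exact (hanti _ (hmaps hξr) (le_max_right k l)).trans (hl ξ hξ hξr)
    have := (hφ k).2.2.2 z hz w r hr hdisc (p + Polynomial.C (ε : ℂ)) (by
      intro ξ hξ
      simpa using hk ξ (by simpa using hξ)) ζ hζ
    refine (iInf_le _ k).trans (this.trans ?_)
    simp

theorem lowerSemicontinuousOn_lscReg {n : ℕ} (A : Set (Fin n → ℂ)) (g : (Fin n → ℂ) → EReal) :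
    LowerSemicontinuousOn (lscReg A g) A := by
  intro z hz c hc
  obtain ⟨d, hcd, hd⟩ := exists_between hc
  have h := eventually_lt_of_lt_liminf hd
  filter_upwards [eventually_eventually_nhdsWithin.2 h] with x hx
  exact hcd.trans_le (le_liminf_of_le (by isBoundedDefault) (hx.mono fun _ h => h.le))

theorem lscReg_le {n : ℕ} {A : Set (Fin n → ℂ)} (g : (Fin n → ℂ) → EReal) {z : Fin n → ℂ}
    (hz : z ∈ A) : lscReg A g z ≤ g z := by
  refine le_of_forall_lt fun c hc => ?_
  exact (eventually_lt_of_lt_liminf hc).self_of_nhdsWithin hz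

theorem le_lscReg {n : ℕ} {A : Set (Fin n → ℂ)} {g : (Fin n → ℂ) → EReal} {z : Fin n → ℂ}
    {c : EReal} (h : ∀ᶠ x in 𝓝[A] z, c ≤ g x) : c ≤ lscReg A g z :=
  le_liminf_of_le (by isBoundedDefault) h

theorem lscReg_mono {n : ℕ} {A : Set (Fin n → ℂ)} {g g' : (Fin n → ℂ) → EReal}
    (h : ∀ x ∈ A, g x ≤ g' x) (z : Fin n → ℂ) : lscReg A g z ≤ lscReg A g' z :=
  liminf_le_liminf (eventually_nhdsWithin_of_forall h)

/-- The minimum principle of a plurisuperharmonic function on discs. -/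
theorem IsPSupH.le_of_le_circle {n : ℕ} {Ω : Set (Fin n → ℂ)} {v : (Fin n → ℂ) → EReal}
    (hv : IsPSupH Ω v) {z w : Fin n → ℂ} (hz : z ∈ Ω) {r : ℝ} (hr : 0 < r)
    (hdisc : ∀ ζ : ℂ, ‖ζ‖ ≤ r → z + ζ • w ∈ Ω) (p : Polynomial ℂ)
    (hp : ∀ ζ : ℂ, ‖ζ‖ = r → (((p.eval ζ).re : ℝ) : EReal) ≤ v (z + ζ • w))
    (ζ : ℂ) (hζ : ‖ζ‖ ≤ r) : (((p.eval ζ).re : ℝ) : EReal) ≤ v (z + ζ • w) := by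
  have := hv.2.2.2 z hz w r hr hdisc (-p) (fun ξ hξ => by
    simpa using hp ξ hξ) ζ hζ
  simpa using this

/-- The regularized lower envelope of a family of nonnegative plurisuperharmonic functions is
plurisuperharmonic. -/
theorem isPSupH_lscReg_sInf {n : ℕ} {Ω : Set (Fin n → ℂ)} (hΩ : IsOpen Ω)
    (V : Set ((Fin n → ℂ) → EReal)) (hV : ∀ v ∈ V, IsPSupH Ω v ∧ ∀ z ∈ Ω, 0 ≤ v z)
    (hne : V.Nonempty) : IsPSupH Ω (lscReg Ω fun z => ⨅ v ∈ V, v z) := by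
  have hnn : ∀ z ∈ Ω, 0 ≤ lscReg Ω (fun z => ⨅ v ∈ V, v z) z := fun z _ =>
    le_lscReg (eventually_nhdsWithin_of_forall fun x hx => le_iInf₂ fun v hv => (hV v hv).2 x hx)
  have hle : ∀ v ∈ V, ∀ z ∈ Ω, lscReg Ω (fun z => ⨅ v ∈ V, v z) z ≤ v z := fun v hv z hz =>
    (lscReg_le _ hz).trans (iInf₂_le v hv)
  have hlsc := lowerSemicontinuousOn_lscReg Ω (fun z => ⨅ v ∈ V, v z)
  set S := lscReg Ω (fun z => ⨅ v ∈ V, v z) with hS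
  refine ⟨continuous_neg.comp_lowerSemicontinuousOn_antitone hlsc
      (fun a b h => EReal.neg_le_neg_iff.2 h), ?_, ?_, ?_⟩
  · intro z hz h
    have := hnn z hz
    rw [EReal.neg_eq_top_iff.1 h] at this
    simp at this
  · obtain ⟨v, hv⟩ := hne
    obtain ⟨z, hz, hvz⟩ := (hV v hv).1.2.2.1
    refine ⟨z, hz, fun h => hvz ?_⟩
    rw [EReal.neg_eq_bot_iff] at h ⊢
    exact top_le_iff.1 (h.symm.le.trans (hle v hv z hz))
  · intro z hz w r hr hdisc p hp ζ₀ hζ₀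
    suffices h : (((-(p.eval ζ₀).re) : ℝ) : EReal) ≤ S (z + ζ₀ • w) by
      rw [EReal.neg_le]
      simpa using h
    refine EReal.coe_le_of_forall_pos_sub_le fun ε hε => ?_
    have hshift : Continuous fun q : (Fin n → ℂ) × ℂ => z + q.1 + q.2 • w := by fun_prop
    have hin : ∀ᶠ y : Fin n → ℂ in 𝓝 0, ∀ ζ ∈ Metric.closedBall (0 : ℂ) r,
        z + y + ζ • w ∈ Ω := by
      refine (isCompact_closedBall (0 : ℂ) r).eventually_forall_of_forall_eventually fun ζ hζ => ?_
      exact hshift.continuousAt.eventually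
        (hΩ.mem_nhds (by simpa using hdisc ζ (by simpa using hζ)))
    have hbd : ∀ᶠ y : Fin n → ℂ in 𝓝 0, ∀ ζ ∈ Metric.sphere (0 : ℂ) r,
        ((-(p.eval ζ).re - ε : ℝ) : EReal) ≤ S (z + y + ζ • w) := by
      refine (isCompact_sphere (0 : ℂ) r).eventually_forall_of_forall_eventually fun ζ hζ => ?_
      have hζr : ‖ζ‖ = r := by simpa using hζ
      have hζΩ : z + ζ • w ∈ Ω := hdisc ζ hζr.le
      have h1 : ((-(p.eval ζ).re - ε / 2 : ℝ) : EReal) < S (z + ζ • w) := by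
        have h2 := EReal.neg_le.1 (hp ζ hζr)
        refine lt_of_lt_of_le ?_ h2
        rw [← EReal.coe_neg]
        exact_mod_cast (by linarith)
      have h3 : ∀ᶠ x in 𝓝 (z + ζ • w), ((-(p.eval ζ).re - ε / 2 : ℝ) : EReal) < S x := by
        have := hlsc _ hζΩ _ h1
        rwa [hΩ.nhdsWithin_eq hζΩ] at this
      have h4 : ∀ᶠ q : (Fin n → ℂ) × ℂ in 𝓝 (0, ζ),
          ((-(p.eval ζ).re - ε / 2 : ℝ) : EReal) < S (z + q.1 + q.2 • w) :=
        (hshift.tendsto' (0, ζ) (z + ζ • w) (by simp)).eventually h3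
      have h5 : ∀ᶠ q : (Fin n → ℂ) × ℂ in 𝓝 (0, ζ), (p.eval ζ).re - ε / 2 < (p.eval q.2).re :=
        ((Complex.continuous_re.comp p.continuous).comp
          continuous_snd).continuousAt.eventually_const_lt
          (by simp only [Function.comp_apply]; linarith)
      filter_upwards [h4, h5] with q hq4 hq5
      refine le_trans ?_ hq4.le
      exact_mod_cast (by linarith)
    have htend : Tendsto (fun x => x - (z + ζ₀ • w)) (𝓝[Ω] (z + ζ₀ • w)) (𝓝 0) :=
      ((continuous_sub_right (z + ζ₀ • w)).tendsto' _ 0 (sub_self _)).mono_left nhdsWithin_le_nhds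
    refine le_lscReg ?_
    filter_upwards [htend.eventually hin, htend.eventually hbd] with x hx1 hx2
    refine le_iInf₂ fun v hv => ?_
    set y := x - (z + ζ₀ • w) with hy
    have hdisc' : ∀ ζ : ℂ, ‖ζ‖ ≤ r → z + y + ζ • w ∈ Ω := fun ζ hζ => hx1 ζ (by simpa using hζ)
    have := (hV v hv).1.le_of_le_circle (w := w)
      (by simpa using hdisc' 0 (by simpa using hr.le)) hr hdisc'
      (-p - Polynomial.C (ε : ℂ)) (fun ζ hζ => by
        have h1 := (hx2 ζ (by simpa using hζ)).trans (hle v hv _ (hdisc' ζ hζ.le))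
        simpa using h1) ζ₀ hζ₀
    have hxy : z + y + ζ₀ • w = x := by rw [hy]; abel
    rw [hxy] at this
    simpa using this

theorem Slam_eq {n : ℕ} (Ω : Set (Fin n → ℂ)) (f : (Fin n → ℂ) → EReal) (lam : ℝ) :
    Slam Ω f lam = lscReg Ω fun z =>
      ⨅ v ∈ {v | IsPSupH Ω v ∧ ∀ ζ ∈ Ω, max (f ζ - (lam : EReal)) 0 ≤ v ζ}, v z := by
  unfold Slam
  congr 1
  ext z
  unfold Rop
  rw [← sInf_image]
  congr 1
  ext y
  simp only [mem_ofPred_eq, mem_image]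
  exact exists_congr fun v => ⟨fun h => ⟨⟨h.1, h.2.1⟩, h.2.2.symm⟩,
    fun h => ⟨h.1.1, h.1.2, h.2.symm⟩⟩

theorem isPSupH_Slam {n : ℕ} {Ω : Set (Fin n → ℂ)} (hΩ : IsOpen Ω) {f : (Fin n → ℂ) → EReal}
    (hf : MemM Ω f) {lam : ℝ} (hlam : 0 ≤ lam) : IsPSupH Ω (Slam Ω f lam) := by
  rw [Slam_eq]
  refine isPSupH_lscReg_sInf hΩ _
    (fun v hv => ⟨hv.1, fun z hz => (le_max_right _ _).trans (hv.2 z hz)⟩) ?_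
  obtain ⟨hf0, v, hv, hfv⟩ := hf
  refine ⟨v, hv, fun z hz => max_le ?_ ((hf0 z hz).trans (hfv z hz))⟩
  refine le_trans ?_ (hfv z hz)
  exact EReal.sub_le_of_le_add (le_add_of_nonneg_right (by exact_mod_cast hlam))

theorem Slam_nonneg {n : ℕ} {Ω : Set (Fin n → ℂ)} (f : (Fin n → ℂ) → EReal) (lam : ℝ)
    (z : Fin n → ℂ) : 0 ≤ Slam Ω f lam z := by
  rw [Slam_eq]
  exact le_lscReg (eventually_nhdsWithin_of_forall fun x hx => le_iInf₂ fun v hv =>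
    (le_max_right _ _).trans (hv.2 x hx))

theorem Slam_antitone {n : ℕ} (Ω : Set (Fin n → ℂ)) (f : (Fin n → ℂ) → EReal)
    (z : Fin n → ℂ) : Antitone fun lam : ℝ => Slam Ω f lam z := by
  intro a b hab
  simp only [Slam_eq]
  refine lscReg_mono (fun x _ => ?_) z
  refine biInf_mono fun v hv => ⟨hv.1, fun ζ hζ => le_trans ?_ (hv.2 ζ hζ)⟩
  exact max_le_max_right _ (EReal.sub_le_sub le_rfl (by exact_mod_cast hab))

theorem Complex.circleAverage_re_eval (p : Polynomial ℂ) :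
    Real.circleAverage (fun ζ => (p.eval ζ).re) 0 1 = (p.eval 0).re := by
  have h : Real.circleAverage (fun ζ => p.eval ζ) 0 1 = p.eval 0 :=
    DiffContOnCl.circleAverage (Differentiable.diffContOnCl p.differentiable)
  rw [← h]
  have := Complex.reCLM.circleAverage_comp_comm (f := fun ζ => p.eval ζ) (c := 0) (R := 1)
    (ContinuousOn.circleIntegrable' p.continuous.continuousOn)
  exact this

/-- The super-mean value property of a plurisuperharmonic function on circles, tested against
continuous minorants. -/
theorem IsPSupH.circleAverage_le {n : ℕ} {Ω : Set (Fin n → ℂ)} {v : (Fin n → ℂ) → EReal}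
    (hv : IsPSupH Ω v) {z w : Fin n → ℂ} (hdisc : ∀ ζ : ℂ, ‖ζ‖ ≤ 1 → z + ζ • w ∈ Ω)
    {h : ℂ → ℝ} (hh : Continuous h)
    (hhv : ∀ ζ : ℂ, ‖ζ‖ = 1 → (h ζ : EReal) ≤ v (z + ζ • w)) :
    ((Real.circleAverage h 0 1 : ℝ) : EReal) ≤ v z := by
  refine EReal.coe_le_of_forall_pos_sub_le fun ε hε => ?_
  obtain ⟨p, hp⟩ := exists_polynomial_re_near h hh one_pos (half_pos hε)
  have h1 := hv.le_of_le_circle (w := w) (by simpa using hdisc 0 (by simp)) one_pos hdisc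
    (p - Polynomial.C ((ε / 2 : ℝ) : ℂ)) (fun ζ hζ => by
      refine le_trans ?_ (hhv ζ hζ)
      have := abs_lt.1 (hp ζ hζ)
      simp only [Polynomial.eval_sub, Polynomial.eval_C, Complex.sub_re, Complex.ofReal_re]
      exact_mod_cast (by linarith)) 0 (by simp)
  have h2 : Real.circleAverage h 0 1 ≤ Real.circleAverage
      (fun ζ => ((p + Polynomial.C ((ε / 2 : ℝ) : ℂ)).eval ζ).re) 0 1 := by
    refine Real.circleAverage_mono (ContinuousOn.circleIntegrable' hh.continuousOn)
      (ContinuousOn.circleIntegrable'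
        (Complex.continuous_re.comp (Polynomial.continuous _)).continuousOn) fun ζ hζ => ?_
    have := abs_lt.1 (hp ζ (by simpa using hζ))
    simp only [Polynomial.eval_add, Polynomial.eval_C, Complex.add_re, Complex.ofReal_re]
    linarith
  rw [Complex.circleAverage_re_eval] at h2
  simp only [zero_smul, add_zero] at h1
  refine le_trans ?_ h1
  simp only [Polynomial.eval_add, Polynomial.eval_sub, Polynomial.eval_C, Complex.add_re,
    Complex.sub_re, Complex.ofReal_re] at h2 ⊢
  exact_mod_cast (by linarith)

open MeasureTheory in
theorem setIntegral_closedBall_circle_smul {n : ℕ} (a : Circle) (r : ℝ)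
    (g : (Fin n → ℂ) → ℝ) :
    ∫ w in Metric.closedBall (0 : Fin n → ℂ) r, g ((a : ℂ) • w) =
      ∫ w in Metric.closedBall (0 : Fin n → ℂ) r, g w := by
  have ha : (a : ℂ) ≠ 0 := a.coe_ne_zero
  have hmp : MeasurePreserving (fun w : Fin n → ℂ => (a : ℂ) • w) := by
    have h : MeasurePreserving (fun ζ : ℂ => (a : ℂ) * ζ) :=
      (rotation a).measurePreserving
    exact volume_preserving_pi (f := fun (_ : Fin n) (ζ : ℂ) => (a : ℂ) * ζ) fun _ => h
  have hemb : MeasurableEmbedding (fun w : Fin n → ℂ => (a : ℂ) • w) :=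
    (Homeomorph.smulOfNeZero (a : ℂ) ha).measurableEmbedding
  have := hmp.setIntegral_preimage_emb hemb g (Metric.closedBall 0 r)
  rw [← this]
  congr 2
  ext w
  simp [norm_smul, Circle.norm_coe]

open MeasureTheory in
theorem setIntegral_closedBall_circleMap_smul {n : ℕ} (z : Fin n → ℂ) (r θ : ℝ)
    (h : (Fin n → ℂ) → ℝ) :
    ∫ w in Metric.closedBall (0 : Fin n → ℂ) r, h (z + circleMap 0 1 θ • w) =
      ∫ x in Metric.closedBall z r, h x := by
  have h1 := setIntegral_closedBall_circle_smul (Circle.exp θ) r (fun w => h (z + w))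
  have h2 : ((Circle.exp θ : Circle) : ℂ) = circleMap 0 1 θ := by simp [circleMap]
  rw [h2] at h1
  rw [h1]
  have h3 := (measurePreserving_add_left (volume : Measure (Fin n → ℂ)) z).setIntegral_preimage_emb
    (measurableEmbedding_addLeft z) h (Metric.closedBall z r)
  rw [← h3]
  congr 2
  ext w
  simp

open MeasureTheory in
theorem setIntegral_closedBall_circleAverage {n : ℕ} (z : Fin n → ℂ) (r : ℝ)
    {h : (Fin n → ℂ) → ℝ} (hh : Continuous h) :
    ∫ w in Metric.closedBall (0 : Fin n → ℂ) r,
      (∫ θ in (0 : ℝ)..2 * Real.pi, h (z + circleMap 0 1 θ • w)) =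
      2 * Real.pi * ∫ x in Metric.closedBall z r, h x := by
  have hcont : Continuous fun q : ℝ × (Fin n → ℂ) => h (z + circleMap 0 1 q.1 • q.2) := by
    have : Continuous fun q : ℝ × (Fin n → ℂ) => circleMap 0 1 q.1 :=
      (continuous_circleMap 0 1).comp continuous_fst
    fun_prop
  have hInt : Integrable (Function.uncurry fun (θ : ℝ) (w : Fin n → ℂ) =>
      h (z + circleMap 0 1 θ • w))
      ((volume.restrict (Set.uIoc 0 (2 * Real.pi))).prod
        (volume.restrict (Metric.closedBall (0 : Fin n → ℂ) r))) := by
    rw [Measure.prod_restrict]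
    refine IntegrableOn.mono_set (t := Set.uIcc 0 (2 * Real.pi) ×ˢ Metric.closedBall 0 r) ?_
      (Set.prod_mono Set.uIoc_subset_uIcc le_rfl)
    exact hcont.continuousOn.integrableOn_compact (isCompact_uIcc.prod (isCompact_closedBall _ _))
  have hswap := intervalIntegral_integral_swap hInt
  simp_rw [setIntegral_closedBall_circleMap_smul] at hswap
  rw [← hswap, intervalIntegral.integral_const, sub_zero, smul_eq_mul]

open MeasureTheory in
theorem setIntegral_closedBall_le_of_circle_integral_le {n : ℕ} (z : Fin n → ℂ) (r : ℝ)
    {h : (Fin n → ℂ) → ℝ} (hh : Continuous h) {c : ℝ}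
    (hc : ∀ w ∈ Metric.closedBall (0 : Fin n → ℂ) r,
      ∫ θ in (0 : ℝ)..2 * Real.pi, h (z + circleMap 0 1 θ • w) ≤ 2 * Real.pi * c) :
    ∫ x in Metric.closedBall z r, h x ≤ c * volume.real (Metric.closedBall z r) := by
  have hcont : Continuous (Function.uncurry fun (w : Fin n → ℂ) (θ : ℝ) =>
      h (z + circleMap 0 1 θ • w)) := by
    have : Continuous fun q : (Fin n → ℂ) × ℝ => circleMap 0 1 q.2 :=
      (continuous_circleMap 0 1).comp continuous_snd
    simp only [Function.uncurry_def]
    fun_prop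
  have hc2 : Continuous fun w : Fin n → ℂ =>
      ∫ θ in (0 : ℝ)..2 * Real.pi, h (z + circleMap 0 1 θ • w) :=
    intervalIntegral.continuous_parametric_intervalIntegral_of_continuous' hcont _ _
  have hle := setIntegral_mono_on (μ := volume)
    (hc2.continuousOn.integrableOn_compact (isCompact_closedBall _ _))
    (continuousOn_const.integrableOn_compact (isCompact_closedBall _ _))
    measurableSet_closedBall hc
  rw [setIntegral_closedBall_circleAverage z r hh, setIntegral_const, smul_eq_mul,
    (Measure.addHaar_real_closedBall_center volume z r).symm] at hle
  nlinarith [Real.two_pi_pos]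

open MeasureTheory in
/-- The super-mean value property of a plurisuperharmonic function on balls, tested against
continuous minorants. -/
theorem IsPSupH.setIntegral_closedBall_le {n : ℕ} {Ω : Set (Fin n → ℂ)}
    {v : (Fin n → ℂ) → EReal} (hv : IsPSupH Ω v) {z : Fin n → ℂ} {r : ℝ}
    (hball : Metric.closedBall z r ⊆ Ω) {h : (Fin n → ℂ) → ℝ} (hh : Continuous h)
    (hhv : ∀ x ∈ Metric.closedBall z r, (h x : EReal) ≤ v x) {c : ℝ} (hc : v z ≤ (c : EReal)) :
    ∫ x in Metric.closedBall z r, h x ≤ c * volume.real (Metric.closedBall z r) := by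
  have hmem : ∀ w ∈ Metric.closedBall (0 : Fin n → ℂ) r, ∀ ζ : ℂ, ‖ζ‖ ≤ 1 →
      z + ζ • w ∈ Metric.closedBall z r := by
    intro w hw ζ hζ
    rw [mem_closedBall_zero_iff] at hw
    rw [mem_closedBall_iff_norm, add_sub_cancel_left, norm_smul]
    nlinarith [norm_nonneg w, norm_nonneg ζ]
  refine setIntegral_closedBall_le_of_circle_integral_le z r hh fun w hw => ?_
  have h1 := (hv.circleAverage_le (fun ζ hζ => hball (hmem w hw ζ hζ))
    (hh.comp (continuous_complexLine z w))
    (fun ζ hζ => hhv _ (hmem w hw ζ hζ.le))).trans hc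
  have h2 : Real.circleAverage (fun ζ => h (z + ζ • w)) 0 1 ≤ c := EReal.coe_le_coe_iff.1 h1
  rwa [Real.circleAverage_def, smul_eq_mul, inv_mul_le_iff₀ Real.two_pi_pos] at h2

theorem IsPSupH.lowerSemicontinuousOn {n : ℕ} {Ω : Set (Fin n → ℂ)}
    {v : (Fin n → ℂ) → EReal} (hv : IsPSupH Ω v) : LowerSemicontinuousOn v Ω := by
  have := continuous_neg.comp_upperSemicontinuousOn_antitone hv.1
    (fun a b h => EReal.neg_le_neg_iff.2 h)
  simpa [Function.comp_def] using this

open MeasureTheory in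
/-- The regularized reduced function majorizes `u - λ` everywhere. -/
theorem sub_le_Slam {n : ℕ} {Ω : Set (Fin n → ℂ)} (hΩ : IsOpen Ω) {u : (Fin n → ℂ) → EReal}
    (hu : IsPSH Ω u) (hu0 : ∀ z ∈ Ω, 0 ≤ u z) (lam : ℝ) {z : Fin n → ℂ} (hz : z ∈ Ω) :
    u z ≤ Slam Ω u lam z + (lam : EReal) := by
  obtain ⟨t, ht⟩ : ∃ t : ℝ, u z = (t : EReal) :=
    ⟨(u z).toReal, (EReal.coe_toReal (hu.2.1 z hz)
      (fun h => by simpa [h] using hu0 z hz)).symm⟩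
  suffices h : ((t - lam : ℝ) : EReal) ≤ Slam Ω u lam z by
    have := add_le_add_left h (lam : EReal)
    rw [ht]
    refine le_trans ?_ this
    norm_cast
    linarith
  rcases le_or_gt (t - lam) 0 with hneg | hpos
  · exact le_trans (by exact_mod_cast hneg) (Slam_nonneg u lam z)
  refine EReal.ge_of_forall_gt_iff_ge.1 fun c hc => ?_
  have hc : c < t - lam := by exact_mod_cast hc
  obtain ⟨R, hR, hRΩ⟩ := Metric.nhds_basis_closedBall.mem_iff.1 (hΩ.mem_nhds hz)
  set r := R / 2 with hr
  have hr0 : 0 < r := by positivity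
  set d := Module.finrank ℝ (Fin n → ℂ)
  obtain ⟨s, hcs, hs0, hsr⟩ : ∃ s, c * r ^ d < (t - lam) * s ^ d ∧ 0 < s ∧ s < r := by
    have h1 : ∀ᶠ s in 𝓝 r, c * r ^ d < (t - lam) * s ^ d :=
      (Continuous.tendsto (f := fun s : ℝ => (t - lam) * s ^ d) (by fun_prop) r).eventually_const_lt
        (by have : 0 < r ^ d := by positivity
            nlinarith)
    have h2 : ∀ᶠ s in 𝓝[<] r, c * r ^ d < (t - lam) * s ^ d := h1.filter_mono nhdsWithin_le_nhds
    exact (h2.and (Ioo_mem_nhdsLT hr0)).exists.imp fun s hs => ⟨hs.1, hs.2.1, hs.2.2⟩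
  have hvol : ∀ (x : Fin n → ℂ) (ρ : ℝ), 0 ≤ ρ → volume.real (Metric.closedBall x ρ) =
      ρ ^ d * volume.real (Metric.ball (0 : Fin n → ℂ) 1) := fun x ρ hρ =>
    Measure.addHaar_real_closedBall _ _ hρ
  have hω : 0 < volume.real (Metric.ball (0 : Fin n → ℂ) 1) :=
    ENNReal.toReal_pos (Metric.measure_ball_pos _ _ one_pos).ne' measure_ball_lt_top.ne
  rw [Slam_eq]
  refine le_lscReg (eventually_nhdsWithin_of_eventually_nhds ?_)
  filter_upwards [Metric.closedBall_mem_nhds z (sub_pos.2 hsr)] with y hy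
  refine le_iInf₂ fun v hv => ?_
  have hyR : Metric.closedBall y r ⊆ Ω := by
    refine (Metric.closedBall_subset_closedBall' ?_).trans hRΩ
    rw [Metric.mem_closedBall] at hy
    linarith
  have hsy : Metric.closedBall z s ⊆ Metric.closedBall y r := by
    refine Metric.closedBall_subset_closedBall' ?_
    rw [Metric.mem_closedBall, dist_comm] at hy
    linarith
  refine EReal.le_of_forall_lt_iff_le.1 fun b hb => ?_
  obtain ⟨b', hvb', hb'⟩ := EReal.lt_iff_exists_real_btwn.1 hb
  have hb' : b' < b := by exact_mod_cast hb'
  have hε : 0 < b - b' := sub_pos.2 hb'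
  obtain ⟨h, hh⟩ : ∃ h : C(Fin n → ℂ, ℝ), ∀ x ∈ Metric.closedBall y r,
      0 ≤ h x ∧ u x ≤ ((h x + lam : ℝ) : EReal) ∧ ((h x - (b - b') : ℝ) : EReal) ≤ v x := by
    have hlsc : LowerSemicontinuousOn (fun x => v x + ((lam + (b - b') : ℝ) : EReal))
        (Metric.closedBall y r) := by
      refine (hv.1.lowerSemicontinuousOn.mono hyR).add' lowerSemicontinuousOn_const fun x _ => ?_
      exact EReal.continuousAt_add (Or.inr (EReal.coe_ne_bot _)) (Or.inr (EReal.coe_ne_top _))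
    have husc : UpperSemicontinuousOn (fun x => max (u x) (lam : EReal)) (Metric.closedBall y r) :=
      (hu.1.mono hyR).sup upperSemicontinuousOn_const
    obtain ⟨g, hg⟩ := exists_continuous_between Metric.isClosed_closedBall husc hlsc (by
      intro x hx
      have h1 := hv.2 x (hyR hx)
      have h2 := hu.2.1 x (hyR hx)
      have h3 := hu0 x (hyR hx)
      generalize u x = p at *
      generalize v x = q at *
      induction p with
      | bot => simp at h3
      | top => simp at h2
      | coe p =>
        induction q with
        | bot => simp at h1
        | top => rw [EReal.top_add_coe]; exact max_lt (EReal.coe_lt_top _) (EReal.coe_lt_top _)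
        | coe q =>
          obtain ⟨h1, h1'⟩ := max_le_iff.1 h1
          norm_cast at h1 h1' ⊢
          exact max_lt (by exact_mod_cast (by linarith : p < q + (lam + (b - b'))))
            (by exact_mod_cast (by linarith : lam < q + (lam + (b - b')))))
    refine ⟨g - ContinuousMap.const _ lam, fun x hx => ?_⟩
    obtain ⟨h1, h2⟩ := hg x hx
    obtain ⟨h1, h1'⟩ := max_lt_iff.1 h1
    simp only [ContinuousMap.sub_apply, ContinuousMap.const_apply]
    refine ⟨?_, ?_, ?_⟩
    · have : lam < g x := by exact_mod_cast h1'
      linarith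
    · simpa using h1.le
    · generalize v x = q at *
      induction q with
      | bot => simp at h2
      | top => simp
      | coe q =>
        norm_cast at *
        linarith
  have I1 := IsPSupH.setIntegral_closedBall_le hv.1 hyR (h := fun x => h x - (b - b'))
    (h.continuous.sub continuous_const) (fun x hx => (hh x hx).2.2) hvb'.le
  have hu' : IsPSupH Ω (fun x => -(u x)) := by
    unfold IsPSupH
    simpa using hu
  have I2 := hu'.setIntegral_closedBall_le (z := z) (r := s) (hsy.trans hyR)
    (h := fun x => -(h x + lam)) (by fun_prop) (fun x hx => by
      rw [EReal.coe_neg]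
      exact EReal.neg_le_neg_iff.2 (hh x (hsy hx)).2.1) (c := -t) (by rw [ht]; simp)
  have hInt : ∀ (x : Fin n → ℂ) (ρ : ℝ), IntegrableOn h (Metric.closedBall x ρ) := fun x ρ =>
    h.continuous.continuousOn.integrableOn_compact (isCompact_closedBall x ρ)
  have hconst : ∀ (x : Fin n → ℂ) (ρ a : ℝ),
      IntegrableOn (fun _ : Fin n → ℂ => a) (Metric.closedBall x ρ) := fun x ρ a =>
    continuousOn_const.integrableOn_compact (isCompact_closedBall x ρ)
  have I3 : ∫ x in Metric.closedBall z s, h x ≤ ∫ x in Metric.closedBall y r, h x :=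
    setIntegral_mono_set (hInt y r)
      ((ae_restrict_iff' measurableSet_closedBall).2 (Eventually.of_forall fun x hx => (hh x hx).1))
      hsy.eventuallyLE
  rw [integral_sub (hInt _ _) (hconst _ _ _), setIntegral_const, smul_eq_mul,
    hvol _ _ hr0.le] at I1
  rw [integral_neg, integral_add (hInt _ _) (hconst _ _ _), setIntegral_const, smul_eq_mul,
    hvol _ _ hs0.le] at I2
  have hrd : 0 < r ^ d := by positivity
  have key : c * (r ^ d * volume.real (Metric.ball (0 : Fin n → ℂ) 1)) ≤
      b * (r ^ d * volume.real (Metric.ball (0 : Fin n → ℂ) 1)) := by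
    nlinarith [mul_lt_mul_of_pos_right hcs hω]
  exact_mod_cast le_of_mul_le_mul_right key (mul_pos hrd hω)

open MeasureTheory in
/-- If a decreasing family of nonnegative plurisuperharmonic functions has a limit whose lower
semicontinuous regularization vanishes, then the limit itself vanishes somewhere. -/
theorem exists_iInf_eq_zero {n : ℕ} {Ω : Set (Fin n → ℂ)} (hΩ : IsOpen Ω)
    (hne : Ω.Nonempty) {v : ℕ → (Fin n → ℂ) → EReal} (hv : ∀ m, IsPSupH Ω (v m))
    (hv0 : ∀ m z, 0 ≤ v m z) (hreg : ∀ z ∈ Ω, lscReg Ω (fun x => ⨅ m, v m x) z = 0) :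
    ∃ z ∈ Ω, ⨅ m, v m z = 0 := by
  by_contra! hT
  have hTpos : ∀ z ∈ Ω, 0 < ⨅ m, v m z := fun z hz =>
    lt_of_le_of_ne (le_iInf fun m => hv0 m z) (hT z hz).symm
  obtain ⟨z, hz⟩ := hne
  obtain ⟨R', hR', hRΩ⟩ := Metric.nhds_basis_closedBall.mem_iff.1 (hΩ.mem_nhds hz)
  set R := R' / 2 with hRdef
  have hR : 0 < R := by positivity
  set B := Metric.ball z (R / 2) with hBdef
  have hBΩ : B ⊆ Ω := by
    refine Metric.ball_subset_closedBall.trans ((Metric.closedBall_subset_closedBall ?_).trans hRΩ)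
    linarith
  have hmeas : ∀ k : ℕ, MeasurableSet
      (⋂ m, {x | x ∈ B ∧ (((1 / (k + 1 : ℝ)) : ℝ) : EReal) < v m x}) := by
    intro k
    refine MeasurableSet.iInter fun m => IsOpen.measurableSet ?_
    rw [isOpen_iff_mem_nhds]
    rintro x ⟨hxB, hx⟩
    have h1 := (hv m).lowerSemicontinuousOn x (hBΩ hxB) _ hx
    rw [(hΩ.mem_nhds (hBΩ hxB) : Ω ∈ 𝓝 x) |> nhdsWithin_eq_nhds.2] at h1
    filter_upwards [Metric.isOpen_ball.mem_nhds hxB, h1] with y hy1 hy2 using ⟨hy1, hy2⟩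
  have hcover : B ⊆ ⋃ k : ℕ, ⋂ m, {x | x ∈ B ∧ (((1 / (k + 1 : ℝ)) : ℝ) : EReal) < v m x} := by
    intro x hx
    obtain ⟨c, hc0, hc⟩ := EReal.lt_iff_exists_real_btwn.1 (hTpos x (hBΩ hx))
    obtain ⟨k, hk⟩ := exists_nat_one_div_lt (show 0 < c by exact_mod_cast hc0)
    refine mem_iUnion.2 ⟨k, mem_iInter.2 fun m => ⟨hx, ?_⟩⟩
    exact (EReal.coe_lt_coe_iff.2 hk).trans (hc.trans_le (iInf_le _ m))
  obtain ⟨k, hk⟩ : ∃ k : ℕ,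
      0 < volume (⋂ m, {x | x ∈ B ∧ (((1 / (k + 1 : ℝ)) : ℝ) : EReal) < v m x}) := by
    by_contra! h
    have h1 := measure_mono_null hcover (measure_iUnion_null fun k => le_antisymm (h k) zero_le)
    exact (Metric.measure_ball_pos volume z (half_pos hR)).ne' h1
  obtain ⟨K, hKF, hK, hKpos⟩ := (hmeas k).exists_lt_isCompact hk
  set c₀ : ℝ := 1 / (k + 1 : ℝ) with hc₀def
  have hc₀ : 0 < c₀ := by positivity
  set V := volume.real (Metric.closedBall z R) with hVdef
  have hV : 0 < V := ENNReal.toReal_pos (Metric.measure_closedBall_pos _ _ hR).ne'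
    measure_closedBall_lt_top.ne
  have hKV : 0 < volume.real K := ENNReal.toReal_pos hKpos.ne' hK.measure_lt_top.ne
  have hlower : ∀ y ∈ B, ∀ m, ((c₀ * volume.real K / V : ℝ) : EReal) ≤ v m y := by
    intro y hy m
    rw [hBdef, Metric.mem_ball] at hy
    have hyR : Metric.closedBall y R ⊆ Ω := by
      refine (Metric.closedBall_subset_closedBall' ?_).trans hRΩ
      linarith
    have hKy : K ⊆ Metric.closedBall y R := by
      refine fun x hx => ?_
      have h1 : dist x z < R / 2 := (mem_iInter.1 (hKF hx) 0).1
      rw [Metric.mem_closedBall]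
      linarith [dist_triangle x z y, dist_comm z y]
    have hVy : volume.real (Metric.closedBall y R) = V :=
      (Measure.addHaar_real_closedBall_center _ y R).trans
        (Measure.addHaar_real_closedBall_center _ z R).symm
    refine EReal.le_of_forall_lt_iff_le.1 fun b hb => ?_
    obtain ⟨b', hvb', hb'⟩ := EReal.lt_iff_exists_real_btwn.1 hb
    have hb' : b' < b := by exact_mod_cast hb'
    have hε : 0 < b - b' := sub_pos.2 hb'
    obtain ⟨h, hh⟩ : ∃ h : C(Fin n → ℂ, ℝ), ∀ x ∈ Metric.closedBall y R,
        K.indicator (fun _ => c₀) x ≤ h x ∧ ((h x - (b - b') : ℝ) : EReal) ≤ v m x := by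
      have hlsc : LowerSemicontinuousOn (fun x => v m x + ((b - b' : ℝ) : EReal))
          (Metric.closedBall y R) := by
        refine ((hv m).lowerSemicontinuousOn.mono hyR).add' lowerSemicontinuousOn_const
          fun x _ => ?_
        exact EReal.continuousAt_add (Or.inr (EReal.coe_ne_bot _)) (Or.inr (EReal.coe_ne_top _))
      have husc : UpperSemicontinuousOn (fun x => ((K.indicator (fun _ => c₀) x : ℝ) : EReal))
          (Metric.closedBall y R) :=
        (continuous_coe_real_ereal.comp_upperSemicontinuous
          (hK.isClosed.upperSemicontinuous_indicator hc₀.le)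
          EReal.coe_strictMono.monotone).upperSemicontinuousOn _
      obtain ⟨g, hg⟩ := exists_continuous_between Metric.isClosed_closedBall husc hlsc (by
        intro x hx
        have h1 : ((K.indicator (fun _ => c₀) x : ℝ) : EReal) ≤ v m x := by
          by_cases hxK : x ∈ K
          · simpa [hxK] using (mem_iInter.1 (hKF hxK) m).2.le
          · simpa [hxK] using hv0 m x
        generalize v m x = q at *
        induction q with
        | bot => simp at h1
        | top => rw [EReal.top_add_coe]; exact EReal.coe_lt_top _
        | coe q =>
          norm_cast at h1 ⊢
          linarith)
      refine ⟨g, fun x hx => ?_⟩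
      obtain ⟨h1, h2⟩ := hg x hx
      refine ⟨by exact_mod_cast h1.le, ?_⟩
      generalize v m x = q at *
      induction q with
      | bot => simp at h2
      | top => simp
      | coe q =>
        norm_cast at *
        linarith
    have I1 := (hv m).setIntegral_closedBall_le hyR (h := fun x => h x - (b - b'))
      (h.continuous.sub continuous_const) (fun x hx => (hh x hx).2) hvb'.le
    have hInt : IntegrableOn h (Metric.closedBall y R) :=
      h.continuous.continuousOn.integrableOn_compact (isCompact_closedBall y R)
    have hconst : ∀ a : ℝ, IntegrableOn (fun _ : Fin n → ℂ => a) (Metric.closedBall y R) :=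
      fun a => continuousOn_const.integrableOn_compact (isCompact_closedBall y R)
    have I2 : ∫ x in Metric.closedBall y R, K.indicator (fun _ => c₀) x ≤
        ∫ x in Metric.closedBall y R, h x :=
      setIntegral_mono_on ((hconst c₀).indicator hK.measurableSet) hInt measurableSet_closedBall
        fun x hx => (hh x hx).1
    rw [setIntegral_indicator hK.measurableSet, inter_eq_self_of_subset_right hKy,
      setIntegral_const, smul_eq_mul] at I2
    rw [integral_sub hInt (hconst _), setIntegral_const, smul_eq_mul, hVy] at I1
    have key : c₀ * volume.real K / V ≤ b := by
      rw [div_le_iff₀ hV]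
      nlinarith
    exact_mod_cast key
  have hc : 0 < c₀ * volume.real K / V := by positivity
  have h1 : ((c₀ * volume.real K / V : ℝ) : EReal) ≤ lscReg Ω (fun x => ⨅ m, v m x) z := by
    refine le_lscReg (eventually_nhdsWithin_of_eventually_nhds ?_)
    filter_upwards [Metric.ball_mem_nhds z (half_pos hR)] with y hy
    exact le_iInf fun m => hlower y hy m
  rw [hreg z hz] at h1
  exact absurd h1 (not_le.2 (by exact_mod_cast hc))

/-- The set where a decreasing sequence of nonnegative plurisuperharmonic functions does not tend
to zero is pluripolar as soon as it omits one point. -/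
theorem pluripolar_iInf_ne_zero {n : ℕ} {Ω : Set (Fin n → ℂ)}
    {v : ℕ → (Fin n → ℂ) → EReal} (hv : ∀ m, IsPSupH Ω (v m)) (hv0 : ∀ m z, 0 ≤ v m z)
    (hpt : ∃ z ∈ Ω, ⨅ m, v m z = 0) :
    Pluripolar Ω {z | z ∈ Ω ∧ ⨅ m, v m z ≠ 0} := by
  obtain ⟨z₀, hz₀, hz₀T⟩ := hpt
  have hsmall : ∀ k : ℕ, ∃ m, v m z₀ < (((1 / 2 : ℝ) ^ k : ℝ) : EReal) := fun k => by
    have : ⨅ m, v m z₀ < (((1 / 2 : ℝ) ^ k : ℝ) : EReal) := by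
      rw [hz₀T]
      exact_mod_cast (by positivity : (0 : ℝ) < (1 / 2) ^ k)
    exact iInf_lt_iff.1 this
  choose m hm using hsmall
  let φ : ℕ → (Fin n → ℂ) → EReal := fun K =>
    Nat.rec (fun z => -(v (m 0) z)) (fun k ψ z => ψ z + -(v (m (k + 1)) z)) K
  have hφ0 : φ 0 = fun z => -(v (m 0) z) := rfl
  have hφs : ∀ K, φ (K + 1) = fun z => φ K z + -(v (m (K + 1)) z) := fun K => rfl
  have hbound : ∀ K, ((-(2 - (1 / 2 : ℝ) ^ K) : ℝ) : EReal) ≤ φ K z₀ := by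
    have hneg : ∀ k, ((-(1 / 2 : ℝ) ^ k : ℝ) : EReal) ≤ -(v (m k) z₀) := fun k => by
      rw [EReal.coe_neg]
      exact EReal.neg_le_neg_iff.2 (hm k).le
    intro K
    induction K with
    | zero =>
      refine le_trans ?_ (hneg 0)
      norm_num
    | succ K ih =>
      refine le_trans ?_ (add_le_add ih (hneg (K + 1)))
      rw [← EReal.coe_add]
      refine EReal.coe_le_coe_iff.2 (le_of_eq ?_)
      ring
  have hpsh : ∀ K, IsPSH Ω (φ K) := by
    intro K
    induction K with
    | zero => exact hv (m 0)
    | succ K ih =>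
      refine IsPSH.add ih (hv _) ⟨z₀, hz₀, ?_, ?_⟩
      · exact ne_bot_of_le_ne_bot (EReal.coe_ne_bot _) (hbound K)
      · rw [Ne, EReal.neg_eq_bot_iff]
        exact ((hm _).trans (EReal.coe_lt_top _)).ne
  have hanti : ∀ z ∈ Ω, Antitone fun K => φ K z := fun z _ =>
    antitone_nat_of_succ_le fun K => by
      have : -(v (m (K + 1)) z) ≤ 0 := by simpa using hv0 (m (K + 1)) z
      simpa [hφs] using add_le_add_right this (φ K z)
  refine ⟨fun z hz => hz.1, fun z => ⨅ K, φ K z,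
    IsPSH.iInf_of_antitone hpsh hanti ⟨z₀, hz₀, ?_⟩, ?_⟩
  · refine ne_bot_of_le_ne_bot (EReal.coe_ne_bot (-2)) (le_iInf fun K => le_trans ?_ (hbound K))
    refine EReal.coe_le_coe_iff.2 ?_
    have : (0 : ℝ) ≤ (1 / 2) ^ K := by positivity
    linarith
  · rintro z ⟨hz, hTz⟩
    have hpos : 0 < ⨅ m, v m z := lt_of_le_of_ne (le_iInf fun m => hv0 m z) hTz.symm
    obtain ⟨c, hc0, hc⟩ := EReal.lt_iff_exists_real_btwn.1 hpos
    have hc0 : 0 < c := by exact_mod_cast hc0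
    have hneg : ∀ k, -(v (m k) z) ≤ ((-c : ℝ) : EReal) := fun k => by
      rw [EReal.coe_neg]
      exact EReal.neg_le_neg_iff.2 (hc.le.trans (iInf_le _ _))
    have hle : ∀ K : ℕ, φ K z ≤ ((-((K + 1 : ℝ) * c) : ℝ) : EReal) := by
      intro K
      induction K with
      | zero => simpa [hφ0] using hneg 0
      | succ K ih =>
        refine (add_le_add ih (hneg (K + 1))).trans ?_
        rw [← EReal.coe_add]
        refine EReal.coe_le_coe_iff.2 (le_of_eq ?_)
        push_cast
        ring
    rw [EReal.eq_bot_iff_forall_lt]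
    intro y
    obtain ⟨K, hK⟩ := exists_nat_gt (-y / c)
    refine ((iInf_le _ K).trans (hle K)).trans_lt (EReal.coe_lt_coe_iff.2 ?_)
    rw [div_lt_iff₀ hc0] at hK
    nlinarith

/-- Theorem 3.1: let `Ω ⊆ ℂⁿ` be a bounded domain and let `u ≥ 0` be a
plurisubharmonic function on `Ω` belonging to `ℳ`. If `u` is tame, then the functions
`u_m = u − S_m u` (`m = 1, 2, …`) form an increasing sequence of plurisubharmonic functions
on `Ω`, each bounded above by `m`, converging to `u` at every point of `Ω` outside a
pluripolar set. -/
theorem statement5 {n : ℕ} (Ω : Set (Fin n → ℂ))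
    (hΩo : IsOpen Ω) (hΩc : IsConnected Ω) (hΩb : Bornology.IsBounded Ω)
    (u : (Fin n → ℂ) → EReal) (hpsh : IsPSH Ω u) (hu0 : ∀ z ∈ Ω, 0 ≤ u z)
    (huM : MemM Ω u) (htame : Tame Ω u) :
    (∀ m : ℕ, 1 ≤ m → IsPSH Ω (fun z => u z - Slam Ω u (m : ℝ) z)) ∧
    (∀ m : ℕ, 1 ≤ m → ∀ z ∈ Ω,
      u z - Slam Ω u (m : ℝ) z ≤ u z - Slam Ω u ((m + 1 : ℕ) : ℝ) z) ∧
    (∀ m : ℕ, 1 ≤ m → ∀ z ∈ Ω, u z - Slam Ω u (m : ℝ) z ≤ ((m : ℝ) : EReal)) ∧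
    (∃ E : Set (Fin n → ℂ), Pluripolar Ω E ∧ ∀ z ∈ Ω \ E,
      Tendsto (fun m : ℕ => u z - Slam Ω u (m : ℝ) z) atTop (nhds (u z))) := by
  have hsup : ∀ m : ℕ, IsPSupH Ω (Slam Ω u (m : ℝ)) := fun m =>
    isPSupH_Slam hΩo huM m.cast_nonneg
  have hanti : ∀ z, Antitone fun m : ℕ => Slam Ω u (m : ℝ) z := fun z =>
    (Slam_antitone Ω u z).comp_monotone Nat.mono_cast
  have hbot : ∀ z ∈ Ω, u z ≠ ⊥ := fun z hz h => by simpa [h] using hu0 z hz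
  have hinf : ∀ z, ⨅ (lam : ℝ) (_ : 0 ≤ lam), Slam Ω u lam z = ⨅ m : ℕ, Slam Ω u (m : ℝ) z :=
    fun z => le_antisymm (le_iInf fun m => iInf₂_le _ m.cast_nonneg)
      (le_iInf₂ fun lam _ => (iInf_le _ ⌈lam⌉₊).trans (Slam_antitone Ω u z (Nat.le_ceil lam)))
  refine ⟨fun m _ => ?_, fun m _ z _ => ?_, fun m _ z hz => ?_,
    {z | z ∈ Ω ∧ ⨅ m : ℕ, Slam Ω u (m : ℝ) z ≠ 0}, ?_, ?_⟩
  · obtain ⟨z, hz, hSz⟩ := (hsup m).2.2.1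
    simpa only [sub_eq_add_neg] using IsPSH.add hpsh (hsup m) ⟨z, hz, hbot z hz, hSz⟩
  · exact EReal.sub_le_sub le_rfl (hanti z m.le_succ)
  · refine EReal.sub_le_of_le_add ?_
    rw [add_comm]
    exact sub_le_Slam hΩo hpsh hu0 m hz
  · refine pluripolar_iInf_ne_zero hsup (fun m z => Slam_nonneg u m z)
      (exists_iInf_eq_zero hΩo hΩc.nonempty hsup (fun m z => Slam_nonneg u m z) fun z hz => ?_)
    have := htame z hz
    simp only [Sop, hinf] at this
    exact this
  · rintro z ⟨hz, hzE⟩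
    have h0 : ⨅ m : ℕ, Slam Ω u (m : ℝ) z = 0 := by
      by_contra h
      exact hzE ⟨hz, h⟩
    have hlim : Tendsto (fun m : ℕ => -(Slam Ω u (m : ℝ) z)) atTop (𝓝 (-0)) :=
      (continuous_neg.tendsto _).comp (h0 ▸ tendsto_atTop_iInf (hanti z))
    rw [neg_zero] at hlim
    have hadd : ContinuousAt (fun p : EReal × EReal => p.1 + p.2) (u z, 0) :=
      EReal.continuousAt_add (Or.inr (by simp)) (Or.inr (by simp))
    have := hadd.tendsto.comp ((tendsto_const_nhds (x := u z)).prodMk_nhds hlim)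
    simpa [Function.comp_def, sub_eq_add_neg] using this
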